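/- If the constant input flow {d_l}_{l∈R} is strictly feasible (i.e., feasible with unique equilibrium flow satisfying fe_l < Φcrit_l for every l ∈ O), then the equilibrium density {ρe_l}_{l∈L} is unique, and it satisfies fe_l = Φout_l(ρe_l) for every l ∈ L. (Proposition 3, uniqueness part) -/

import Mathlib

open scoped BigOperators ENNReal

/-- A traffic network: a finite directed acyclic graph with junctions `V`,
ordinary links `O` and onramps `R`, together with jam densities, demand and
supply functions and split ratios, satisfying the standing assumptions of the
model (Assumptions 1–3 and the structural assumptions). -/
structure TrafficNetwork (V O R : Type) [Fintype V] [Fintype O] [Fintype R]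
    [DecidableEq V] [DecidableEq O] [DecidableEq R] where
  /-- head junction of each link -/
  head : O ⊕ R → V
  /-- tail junction of each ordinary link (onramps have no tail) -/
  tail : O → V
  /-- jam density of each ordinary link -/
  ρjam : O → ℝ
  /-- demand function of each link -/
  Φout : O ⊕ R → ℝ → ℝ
  /-- supply function of each ordinary link -/
  Φin : O → ℝ → ℝ
  /-- split ratios -/
  β : O ⊕ R → O → ℝ
  ρjam_pos : ∀ l, 0 < ρjam l
  Φout_strictMono : ∀ l : O, StrictMonoOn (Φout (Sum.inl l)) (Set.Icc 0 (ρjam l))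
  Φout_zero : ∀ l : O ⊕ R, Φout l 0 = 0
  Φout_nonneg : ∀ l : O, ∀ x ∈ Set.Icc 0 (ρjam l), 0 ≤ Φout (Sum.inl l) x
  Φin_strictAnti : ∀ l : O, StrictAntiOn (Φin l) (Set.Icc 0 (ρjam l))
  Φin_nonneg : ∀ l : O, ∀ x ∈ Set.Icc 0 (ρjam l), 0 ≤ Φin l x
  Φin_jam : ∀ l : O, Φin l (ρjam l) = 0
  ΦoutR_strictMono : ∀ r : R, StrictMonoOn (Φout (Sum.inr r)) (Set.Ici 0)
  ΦoutR_nonneg : ∀ r : R, ∀ x ∈ Set.Ici (0 : ℝ), 0 ≤ Φout (Sum.inr r) x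
  ΦoutR_bddAbove : ∀ r : R, BddAbove (Φout (Sum.inr r) '' Set.Ici 0)
  β_nonneg : ∀ l k, 0 ≤ β l k
  β_le_one : ∀ l k, β l k ≤ 1
  β_support : ∀ l k, 0 < β l k → head l = tail k
  β_pos : ∀ (l : O ⊕ R) (k : O), head l = tail k → 0 < β l k
  β_sum_le_one : ∀ l : O ⊕ R,
    ∑ k ∈ Finset.univ.filter (fun k : O => tail k = head l), β l k ≤ 1
  acyclic : ∃ rank : V → ℕ, ∀ l : O, rank (tail l) < rank (head (Sum.inl l))
  Lin_nonempty : ∀ v : V, ∃ l : O ⊕ R, head l = v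
  ramp_out_nonempty : ∀ r : R, ∃ k : O, tail k = head (Sum.inr r)

namespace TrafficNetwork

variable {V O R : Type} [Fintype V] [Fintype O] [Fintype R]
  [DecidableEq V] [DecidableEq O] [DecidableEq R]
variable (N : TrafficNetwork V O R)

/-- links incoming to a junction -/
def Lin (v : V) : Finset (O ⊕ R) := Finset.univ.filter (fun l => N.head l = v)

/-- (ordinary) links outgoing from a junction -/
def Lout (v : V) : Finset O := Finset.univ.filter (fun k => N.tail k = v)

/-- continuous differentiability of supply and demand on the interiors of their domains -/
def C1 : Prop :=
  (∀ l : O, ContDiffOn ℝ 1 (N.Φout (Sum.inl l)) (Set.Ioo 0 (N.ρjam l))) ∧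
  (∀ l : O, ContDiffOn ℝ 1 (N.Φin l) (Set.Ioo 0 (N.ρjam l))) ∧
  (∀ r : R, ContDiffOn ℝ 1 (N.Φout (Sum.inr r)) (Set.Ioi 0))

/-- the derivative bounds of Assumption 1 -/
def DerivBounds : Prop :=
  (∀ l : O, ∃ M : ℝ, ∀ x ∈ Set.Ioo 0 (N.ρjam l),
      derivWithin (N.Φout (Sum.inl l)) (Set.Ioo 0 (N.ρjam l)) x ≤ M) ∧
  (∀ l : O, ∃ M : ℝ, ∀ x ∈ Set.Ioo 0 (N.ρjam l),
      M ≤ derivWithin (N.Φin l) (Set.Ioo 0 (N.ρjam l)) x) ∧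
  (∀ r : R, ∃ M : ℝ, 0 < M ∧ ∀ x ∈ Set.Ioi (0 : ℝ),
      derivWithin (N.Φout (Sum.inr r)) (Set.Ioi 0) x ≤ M / (1 + x) ^ 2)

/-- full regularity (Assumption 1) -/
def Regular : Prop := N.C1 ∧ N.DerivBounds

/-- For a vector of link demands `δ` and ordinary densities `ρO`, the PP/FIFO scale
factor at junction `v`: the largest `α ∈ [0,1]` such that
`α ⬝ Σ_{j ∈ L^in_v} β_{jk} δ_j ≤ Φin_k(ρ_k)` for every `k ∈ L^out_v`.
(If `L^out_v = ∅` this equals `1`.) -/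
noncomputable def αgen (δ : O ⊕ R → ℝ) (ρO : O → ℝ) (v : V) : ℝ :=
  sSup {a : ℝ | a ∈ Set.Icc (0 : ℝ) 1 ∧
    ∀ k ∈ N.Lout v, a * ∑ j ∈ N.Lin v, N.β j k * δ j ≤ N.Φin k (ρO k)}

/-- generic PP/FIFO outflow given demands `δ` and ordinary densities `ρO` -/
noncomputable def foutGen (δ : O ⊕ R → ℝ) (ρO : O → ℝ) (l : O ⊕ R) : ℝ :=
  N.αgen δ ρO (N.head l) * δ l

/-- generic PP/FIFO inflow of an ordinary link -/
noncomputable def finGen (δ : O ⊕ R → ℝ) (ρO : O → ℝ) (l : O) : ℝ :=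
  ∑ k ∈ N.Lin (N.tail l), N.β k l * N.foutGen δ ρO k

/-- link demands at density `ρ` -/
def demand (ρ : O ⊕ R → ℝ) (l : O ⊕ R) : ℝ := N.Φout l (ρ l)

/-- PP/FIFO scale factor at junction `v` at density `ρ` -/
noncomputable def αjunc (ρ : O ⊕ R → ℝ) (v : V) : ℝ :=
  N.αgen (N.demand ρ) (fun k => ρ (Sum.inl k)) v

/-- PP/FIFO outflow `fout_l(ρ)` -/
noncomputable def fout (ρ : O ⊕ R → ℝ) : O ⊕ R → ℝ :=
  N.foutGen (N.demand ρ) (fun k => ρ (Sum.inl k))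

/-- PP/FIFO inflow `fin_l(ρ)` of an ordinary link -/
noncomputable def fin (ρ : O ⊕ R → ℝ) (l : O) : ℝ :=
  N.finGen (N.demand ρ) (fun k => ρ (Sum.inl k)) l

/-- the state space `D` -/
def memD (ρ : O ⊕ R → ℝ) : Prop :=
  (∀ r : R, 0 ≤ ρ (Sum.inr r)) ∧ ∀ l : O, ρ (Sum.inl l) ∈ Set.Icc 0 (N.ρjam l)

/-- the state space `D` as a set -/
def Dset : Set (O ⊕ R → ℝ) := {ρ | N.memD ρ}

/-- `ρe ∈ D` is an equilibrium density for the constant input flow `d` -/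
def IsEquilibrium (d : R → ℝ) (ρe : O ⊕ R → ℝ) : Prop :=
  N.memD ρe ∧ (∀ r : R, N.fout ρe (Sum.inr r) = d r) ∧
    ∀ l : O, N.fout ρe (Sum.inl l) = N.fin ρe l

/-- the input flow `d` is feasible -/
def Feasible (d : R → ℝ) : Prop := ∃ ρe, N.IsEquilibrium d ρe

/-- `x` is the critical density of ordinary link `l`, where demand equals supply;
`Φcrit_l = Φout_l x = Φin_l x`. -/
def IsCrit (l : O) (x : ℝ) : Prop :=
  x ∈ Set.Icc 0 (N.ρjam l) ∧ N.Φout (Sum.inl l) x = N.Φin l x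

/-- supremum `Φ̄out_r` of the demand of onramp `r` -/
noncomputable def Φbar (r : R) : ℝ := sSup (N.Φout (Sum.inr r) '' Set.Ici 0)

/-- the routing matrix `A`, `A_{lk} = β_{kl}` for `l,k ∈ O` -/
def Amat : Matrix O O ℝ := Matrix.of fun l k => N.β (Sum.inl k) l

/-- the input routing matrix `B`, `B_{lr} = β_{rl}` for `l ∈ O`, `r ∈ R` -/
def Bmat : Matrix O R ℝ := Matrix.of fun l r => N.β (Sum.inr r) l

/-- the vector field `F` of the dynamics `ρ̇ = F(ρ)` with constant input `d` -/
noncomputable def Fvec (d : R → ℝ) (ρ : O ⊕ R → ℝ) : O ⊕ R → ℝ :=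
  Sum.elim (fun l => N.fin ρ l - N.fout ρ (Sum.inl l))
    (fun r => d r - N.fout ρ (Sum.inr r))

/-- `ρ : ℝ → D` is a trajectory of the network dynamics (for `t ≥ 0`) -/
noncomputable def IsTrajectory (d : R → ℝ) (ρ : ℝ → O ⊕ R → ℝ) : Prop :=
  ∀ t : ℝ, 0 ≤ t → HasDerivAt ρ (N.Fvec d (ρ t)) t

/-! ### Generalized (extended) state allowing infinite onramp densities -/

/-- demand vector for an extended state, where an onramp with infinite density
has demand `Φ̄out` -/
noncomputable def δext (ρO : O → ℝ) (ρR : R → ℝ≥0∞) : O ⊕ R → ℝ :=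
  Sum.elim (fun l => N.Φout (Sum.inl l) (ρO l))
    (fun r => if ρR r = ⊤ then N.Φbar r else N.Φout (Sum.inr r) (ρR r).toReal)

/-- PP/FIFO outflow at an extended state -/
noncomputable def foutExt (ρO : O → ℝ) (ρR : R → ℝ≥0∞) : O ⊕ R → ℝ :=
  N.foutGen (N.δext ρO ρR) ρO

/-- PP/FIFO inflow at an extended state -/
noncomputable def finExt (ρO : O → ℝ) (ρR : R → ℝ≥0∞) (l : O) : ℝ :=
  N.finGen (N.δext ρO ρR) ρO l

/-- generalized equilibrium (Definition 3): ordinary links balance and each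
onramp either transmits its input flow or has infinite density -/
def IsGenEquilibrium (d : R → ℝ) (ρO : O → ℝ) (ρR : R → ℝ≥0∞) : Prop :=
  (∀ l : O, ρO l ∈ Set.Icc 0 (N.ρjam l)) ∧
  (∀ l : O, N.foutExt ρO ρR (Sum.inl l) = N.finExt ρO ρR l) ∧
  (∀ r : R, N.foutExt ρO ρR (Sum.inr r) = d r ∨
      (N.foutExt ρO ρR (Sum.inr r) < d r ∧ ρR r = ⊤))

/-! ### Ramp metering -/

/-- demand vector for the metered network with metering rates `m` -/
noncomputable def δextM (m : R → ℝ) (ρO : O → ℝ) (ρR : R → ℝ≥0∞) : O ⊕ R → ℝ :=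
  Sum.elim (fun l => N.Φout (Sum.inl l) (ρO l))
    (fun r => min (if ρR r = ⊤ then N.Φbar r else N.Φout (Sum.inr r) (ρR r).toReal) (m r))

/-- PP/FIFO outflow of the metered network -/
noncomputable def foutM (m : R → ℝ) (ρO : O → ℝ) (ρR : R → ℝ≥0∞) : O ⊕ R → ℝ :=
  N.foutGen (N.δextM m ρO ρR) ρO

/-- PP/FIFO inflow of the metered network -/
noncomputable def finM (m : R → ℝ) (ρO : O → ℝ) (ρR : R → ℝ≥0∞) (l : O) : ℝ :=
  N.finGen (N.δextM m ρO ρR) ρO l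

/-- generalized equilibrium of the metered network -/
def IsGenEquilibriumM (m : R → ℝ) (d : R → ℝ) (ρO : O → ℝ) (ρR : R → ℝ≥0∞) : Prop :=
  (∀ l : O, ρO l ∈ Set.Icc 0 (N.ρjam l)) ∧
  (∀ l : O, N.foutM m ρO ρR (Sum.inl l) = N.finM m ρO ρR l) ∧
  (∀ r : R, N.foutM m ρO ρR (Sum.inr r) = d r ∨
      (N.foutM m ρO ρR (Sum.inr r) < d r ∧ ρR r = ⊤))

end TrafficNetwork

namespace TrafficNetwork

variable {V O R : Type} [Fintype V] [Fintype O] [Fintype R]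
  [DecidableEq V] [DecidableEq O] [DecidableEq R]
variable (N : TrafficNetwork V O R)

open Filter Topology

/-- The supremum defining the scale factor is attained, as soon as all supplies are nonnegative. -/
lemma αgen_mem (δ : O ⊕ R → ℝ) (ρO : O → ℝ) (v : V) (hs : ∀ k, 0 ≤ N.Φin k (ρO k)) :
    N.αgen δ ρO v ∈ {a : ℝ | a ∈ Set.Icc (0 : ℝ) 1 ∧
      ∀ k ∈ N.Lout v, a * ∑ j ∈ N.Lin v, N.β j k * δ j ≤ N.Φin k (ρO k)} := by
  refine IsClosed.csSup_mem ?_ ⟨0, ⟨le_rfl, zero_le_one⟩, fun k _ => by simpa using hs k⟩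
    ⟨1, fun a ha => ha.1.2⟩
  simp only [Set.ofPred_and, Set.ofPred_forall]
  exact isClosed_Icc.inter <| isClosed_iInter fun k => isClosed_iInter fun _ =>
    isClosed_le (by fun_prop) continuous_const

/-- A scale factor below one saturates the supply of some outgoing link. -/
lemma exists_supply_eq_of_αgen_lt_one (δ : O ⊕ R → ℝ) (ρO : O → ℝ) (v : V)
    (hs : ∀ k, 0 ≤ N.Φin k (ρO k)) (hlt : N.αgen δ ρO v < 1) :
    ∃ k ∈ N.Lout v, N.αgen δ ρO v * ∑ j ∈ N.Lin v, N.β j k * δ j = N.Φin k (ρO k) := by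
  by_contra! hne
  have hmem := N.αgen_mem δ ρO v hs
  have hev : ∀ᶠ a in 𝓝[>] (N.αgen δ ρO v),
      ∀ k ∈ N.Lout v, a * ∑ j ∈ N.Lin v, N.β j k * δ j < N.Φin k (ρO k) := by
    refine nhdsWithin_le_nhds ((Finset.eventually_all _).2 fun k hk => ?_)
    have hc : Continuous fun a : ℝ => a * ∑ j ∈ N.Lin v, N.β j k * δ j := by fun_prop
    exact hc.continuousAt.eventually_lt_const (lt_of_le_of_ne (hmem.2 k hk) (hne k hk))
  obtain ⟨a, ha, hlta, ha1⟩ := (hev.and (Ioo_mem_nhdsGT hlt)).exists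
  exact hlta.not_ge (le_csSup ⟨1, fun b hb => hb.1.2⟩
    ⟨⟨hmem.1.1.trans hlta.le, ha1.le⟩, fun k hk => (ha k hk).le⟩)

variable {N}

/-- Along an equilibrium whose ordinary flows are all below critical, no junction is congested. -/
lemma IsEquilibrium.αjunc_eq_one {d : R → ℝ} {ρcrit : O → ℝ}
    (hcrit : ∀ l, N.IsCrit l (ρcrit l)) {ρ : O ⊕ R → ℝ} (h : N.IsEquilibrium d ρ)
    (hlt : ∀ l : O, N.fout ρ (Sum.inl l) < N.Φin l (ρcrit l)) (v : V) :
    N.αjunc ρ v = 1 := by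
  obtain ⟨⟨-, hD⟩, -, hbal⟩ := h
  obtain ⟨rank, hrank⟩ := N.acyclic
  have hs : ∀ k, 0 ≤ N.Φin k (ρ (Sum.inl k)) := fun k => N.Φin_nonneg k _ (hD k)
  have hwf : WellFounded fun a b : V => rank b < rank a :=
    haveI : IsTrans V fun a b => rank b < rank a := ⟨fun _ _ _ hab hbc => hbc.trans hab⟩
    haveI : Std.Irrefl fun a b : V => rank b < rank a := ⟨fun _ => lt_irrefl _⟩
    Finite.wellFounded_of_trans_of_irrefl _
  induction v using hwf.induction with
  | _ v ih =>
  by_contra hne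
  have hmem := N.αgen_mem (N.demand ρ) (fun k => ρ (Sum.inl k)) v hs
  obtain ⟨k, hk, heq⟩ := N.exists_supply_eq_of_αgen_lt_one (N.demand ρ) (fun k => ρ (Sum.inl k)) v
    hs (lt_of_le_of_ne hmem.1.2 hne)
  obtain rfl : N.tail k = v := (Finset.mem_filter.1 hk).2
  have hfin : N.fin ρ k = N.Φin k (ρ (Sum.inl k)) := by
    rw [← heq, fin, finGen, Finset.mul_sum]
    refine Finset.sum_congr rfl fun j hj => ?_
    rw [foutGen, (Finset.mem_filter.1 hj).2]
    ring
  have hout : N.fout ρ (Sum.inl k) = N.Φout (Sum.inl k) (ρ (Sum.inl k)) := by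
    have := ih _ (hrank k)
    rw [αjunc] at this
    rw [fout, foutGen, this, one_mul, demand]
  have hsup : N.Φin k (ρ (Sum.inl k)) < N.Φin k (ρcrit k) := by
    rw [← hfin, ← hbal k]
    exact hlt k
  have hdens : ρcrit k < ρ (Sum.inl k) :=
    ((N.Φin_strictAnti k).lt_iff_gt (hD k) (hcrit k).1).1 hsup
  have hdem := N.Φout_strictMono k (hcrit k).1 (hD k) hdens
  rw [(hcrit k).2, ← hout] at hdem
  exact hdem.not_gt (hlt k)

/-- The flows at equilibrium are determined by the input flow. -/
lemma IsEquilibrium.fout_eq {d : R → ℝ} {ρ ρ' : O ⊕ R → ℝ} (h : N.IsEquilibrium d ρ)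
    (h' : N.IsEquilibrium d ρ') : N.fout ρ = N.fout ρ' := by
  obtain ⟨rank, hrank⟩ := N.acyclic
  have key : ∀ n, ∀ l, rank (N.head l) = n → N.fout ρ l = N.fout ρ' l := by
    intro n
    induction n using Nat.strong_induction_on with
    | _ n ih =>
    rintro (l | r) hl
    · rw [h.2.2 l, h'.2.2 l]
      refine Finset.sum_congr rfl fun k hk => congrArg (N.β k l * ·) ?_
      have hk' : N.head k = N.tail l := (Finset.mem_filter.1 hk).2
      exact ih _ (by rw [hk', ← hl]; exact hrank l) k rfl
    · rw [h.2.1 r, h'.2.1 r]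
  exact funext fun l => key _ l rfl

/-- On the state space, the demands determine the density. -/
lemma memD.eq_of_demand_eq {ρ ρ' : O ⊕ R → ℝ} (h : N.memD ρ) (h' : N.memD ρ')
    (heq : ∀ l, N.Φout l (ρ l) = N.Φout l (ρ' l)) : ρ = ρ' := by
  funext l
  rcases l with l | r
  · exact (N.Φout_strictMono l).injOn (h.2 l) (h'.2 l) (heq _)
  · exact (N.ΦoutR_strictMono r).injOn (h.1 r) (h'.1 r) (heq _)

end TrafficNetwork

/-- **Proposition 3, uniqueness part.** If the constant input
flow `{d_l}` is strictly feasible (i.e. feasible with every equilibrium flow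
satisfying `fe_l < Φcrit_l` for every `l ∈ O`), then the equilibrium density
`{ρe_l}` is unique, and it satisfies `fe_l = Φout_l(ρe_l)` for every
`l ∈ L`. -/
theorem stmt6 {V O R : Type} [Fintype V] [Fintype O] [Fintype R]
    [DecidableEq V] [DecidableEq O] [DecidableEq R]
    (N : TrafficNetwork V O R)
    (d : R → ℝ) (hd : ∀ r, 0 ≤ d r)
    (ρcrit : O → ℝ) (hcrit : ∀ l, N.IsCrit l (ρcrit l))
    (hfeas : N.Feasible d)
    (hstrict : ∀ ρe : O ⊕ R → ℝ, N.IsEquilibrium d ρe →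
      ∀ l : O, N.fout ρe (Sum.inl l) < N.Φin l (ρcrit l)) :
    (∃! ρe : O ⊕ R → ℝ, N.IsEquilibrium d ρe) ∧
    (∀ ρe : O ⊕ R → ℝ, N.IsEquilibrium d ρe →
      ∀ l : O ⊕ R, N.fout ρe l = N.Φout l (ρe l)) := by
  have hfree : ∀ ρe : O ⊕ R → ℝ, N.IsEquilibrium d ρe →
      ∀ l : O ⊕ R, N.fout ρe l = N.Φout l (ρe l) := by
    intro ρe h l
    have hα := h.αjunc_eq_one hcrit (hstrict ρe h) (N.head l)
    rw [TrafficNetwork.αjunc] at hα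
    rw [TrafficNetwork.fout, TrafficNetwork.foutGen, hα, one_mul, TrafficNetwork.demand]
  obtain ⟨ρe, h⟩ := hfeas
  refine ⟨⟨ρe, h, fun ρ' h' => ?_⟩, hfree⟩
  refine h'.1.eq_of_demand_eq h.1 fun l => ?_
  rw [← hfree ρ' h' l, ← hfree ρe h l, h'.fout_eq h]
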